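/- Let d ≥ 1 and let P ⊆ ℝ^d be a nondegenerate compact strictly convex set. Then for every target set A ⊆ ℝ^d the no-β McMullen game G_P(A) is equivalent to the perfect set game: player I has a winning strategy in G_P(A) if and only if A contains a perfect set, and player II has a winning strategy in G_P(A) if and only if A is countable. -/

import Mathlib

open Pointwise Filter Topology Set

/-- The set played by the move `c = (x, ρ)`: the translated scaled copy `x + ρ • P` of `P`. -/
def copySet {X : Type*} [AddCommGroup X] [Module ℝ X] (P : Set X) (c : X × ℝ) : Set X :=
  c.1 +ᵥ c.2 • P

/-- The rule that the `n`-th move of the run `m` must obey in the no-β McMullen game: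
every scaling factor is positive; player II's scaling factor is strictly smaller than that of
player I's preceding move; and each of player I's moves after the first is contained in his
previous move with player II's intervening move removed. -/
def Rule {X : Type*} [AddCommGroup X] [Module ℝ X] (P : Set X) (m : ℕ → X × ℝ) (n : ℕ) : Prop :=
  0 < (m n).2 ∧
    (if n % 2 = 1 then (m n).2 < (m (n - 1)).2
     else n ≠ 0 → copySet P (m n) ⊆ copySet P (m (n - 2)) \ copySet P (m (n - 1)))

/-- A strategy: a function assigning a next move to each finite position. -/
abbrev Strategy (X : Type*) := List (X × ℝ) → X × ℝ

/-- The run `m` is one in which player I follows the strategy `σ` (player I moves at the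
even rounds). -/
def FollowsI {X : Type*} (σ : Strategy X) (m : ℕ → X × ℝ) : Prop :=
  ∀ n, m (2 * n) = σ (List.ofFn fun i : Fin (2 * n) => m i)

/-- The run `m` is one in which player II follows the strategy `σ` (player II moves at the
odd rounds). -/
def FollowsII {X : Type*} (σ : Strategy X) (m : ℕ → X × ℝ) : Prop :=
  ∀ n, m (2 * n + 1) = σ (List.ofFn fun i : Fin (2 * n + 1) => m i)

/-- `σ` is a winning strategy for player I in the no-β McMullen game `G_P(A)`:
in every run in which player I follows `σ`, player I is never the first to violate the rules,
and if the run obeys all the rules then `(⋂ n, P_{2n}) ∩ A ≠ ∅`. -/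
def WinningI {X : Type*} [AddCommGroup X] [Module ℝ X] (P A : Set X) (σ : Strategy X) : Prop :=
  ∀ m : ℕ → X × ℝ, FollowsI σ m →
    (∀ n, (∀ k < 2 * n, Rule P m k) → Rule P m (2 * n)) ∧
    ((∀ n, Rule P m n) → ((⋂ n, copySet P (m (2 * n))) ∩ A).Nonempty)

/-- `σ` is a winning strategy for player II in the no-β McMullen game `G_P(A)`:
in every run in which player II follows `σ`, player II is never the first to violate the rules,
and if the run obeys all the rules then `(⋂ n, P_{2n}) ∩ A = ∅`. -/
def WinningII {X : Type*} [AddCommGroup X] [Module ℝ X] (P A : Set X) (σ : Strategy X) : Prop :=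
  ∀ m : ℕ → X × ℝ, FollowsII σ m →
    (∀ n, (∀ k < 2 * n + 1, Rule P m k) → Rule P m (2 * n + 1)) ∧
    ((∀ n, Rule P m n) → (⋂ n, copySet P (m (2 * n))) ∩ A = ∅)

/-- `A` contains a perfect set (a nonempty closed set with no isolated points). -/
def ContainsPerfectSet {X : Type*} [TopologicalSpace X] (A : Set X) : Prop :=
  ∃ F : Set X, F ⊆ A ∧ Perfect F ∧ F.Nonempty


theorem mem_copySet {X : Type*} [AddCommGroup X] [Module ℝ X] {P : Set X} {c : X × ℝ} {z : X} :
    z ∈ copySet P c ↔ ∃ p ∈ P, z = c.1 + c.2 • p := by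
  unfold copySet
  constructor
  · rintro ⟨_, ⟨p, hp, rfl⟩, rfl⟩
    exact ⟨p, hp, rfl⟩
  · rintro ⟨p, hp, rfl⟩
    exact ⟨_, ⟨p, hp, rfl⟩, rfl⟩

section Geo

variable {E : Type*} [NormedAddCommGroup E] [NormedSpace ℝ E]

theorem copySet_compact {P : Set E} (hP : IsCompact P) (c : E × ℝ) : IsCompact (copySet P c) :=
  (hP.smul c.2).vadd c.1

theorem copySet_convex {P : Set E} (hP : Convex ℝ P) (c : E × ℝ) : Convex ℝ (copySet P c) :=
  (hP.smul c.2).vadd c.1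

theorem copySet_diam {P : Set E} (c : E × ℝ) (hc : 0 < c.2) :
    Metric.diam (copySet P c) = c.2 * Metric.diam P := by
  unfold copySet
  rw [diam_vadd, diam_smul₀, Real.norm_of_nonneg hc.le]

theorem geo_lemma {P : Set E} (hP : IsCompact P) (hsc : StrictConvex ℝ P) (hnt : P.Nontrivial) :
    ∃ κ > 0, ∃ K > 0, ∀ x y : E, x ≠ y → ∃ c : E × ℝ, 0 < c.2 ∧ x ∈ copySet P c ∧
      y ∈ copySet P c ∧
      (∀ c' : E × ℝ, 0 < c'.2 → c'.2 < c.2 → ¬ (x ∈ copySet P c' ∧ y ∈ copySet P c')) ∧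
      copySet P c ⊆ Metric.closedBall x (K * ‖y - x‖) ∧
      Metric.ball ((1/2 : ℝ) • (x + y)) (κ * ‖y - x‖) ⊆ copySet P c := by
  obtain ⟨o, ho⟩ : (interior P).Nonempty := by
    obtain ⟨p, hp, q, hq, hpq⟩ := hnt
    exact ⟨_, hsc hp hq hpq (by norm_num : (0:ℝ) < 1/2) (by norm_num : (0:ℝ) < 1/2) (by norm_num)⟩
  obtain ⟨r, hr, hrP⟩ := Metric.isOpen_iff.1 isOpen_interior o ho
  have hrP' : Metric.ball o r ⊆ P := hrP.trans interior_subset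
  obtain ⟨D, hDpos, hD⟩ : ∃ D > 0, ∀ a ∈ P, ∀ b ∈ P, ‖a - b‖ ≤ D := by
    refine ⟨Metric.diam P + 1, by linarith [Metric.diam_nonneg (s := P)], fun a ha b hb => ?_⟩
    rw [← dist_eq_norm]
    linarith [Metric.dist_le_diam_of_mem hP.isBounded ha hb]
  set η := r / 2 with hη
  have hηpos : 0 < η := by positivity
  -- midpoints
  obtain ⟨δ, hδ, hδP⟩ : ∃ δ > 0, ∀ p ∈ P, ∀ q ∈ P, η ≤ ‖p - q‖ →
      Metric.ball ((1/2 : ℝ) • (p + q)) δ ⊆ P := by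
    have hS : IsCompact ((P ×ˢ P) ∩ {z : E × E | η ≤ ‖z.1 - z.2‖}) :=
      (hP.prod hP).inter_right (isClosed_le continuous_const (by fun_prop))
    have hM := hS.image (f := fun z : E × E => (1/2 : ℝ) • (z.1 + z.2)) (by fun_prop)
    obtain ⟨δ, hδ, h⟩ := hM.exists_thickening_subset_open (isOpen_interior (s := P)) (by
      rintro _ ⟨⟨p, q⟩, ⟨⟨hp, hq⟩, hpq⟩, rfl⟩
      have hne : p ≠ q := by
        rintro rfl
        simp at hpq
        linarith
      have := hsc hp hq hne (by norm_num : (0:ℝ) < 1/2) (by norm_num : (0:ℝ) < 1/2) (by norm_num)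
      simpa [smul_add] using this)
    refine ⟨δ, hδ, fun p hp q hq hpq => ?_⟩
    refine (Metric.ball_subset_thickening ?_ δ).trans (h.trans interior_subset)
    exact ⟨(p, q), ⟨⟨hp, hq⟩, hpq⟩, rfl⟩
  refine ⟨δ / D, by positivity, D / η, by positivity, fun x y hxy => ?_⟩
  set w := y - x with hw
  have hw0 : 0 < ‖w‖ := norm_pos_iff.2 (sub_ne_zero.2 hxy.symm)
  -- maximal t
  let T : Set ℝ := {t | t • w ∈ P - P}
  have hTne : r / 2 / ‖w‖ ∈ T := by
    refine ⟨o + (r / 2 / ‖w‖) • w, hrP' ?_, o, hrP' (Metric.mem_ball_self hr), by simp⟩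
    rw [Metric.mem_ball, dist_eq_norm, add_sub_cancel_left, norm_smul, Real.norm_of_nonneg (by positivity)]
    rw [div_mul_cancel₀ _ hw0.ne']
    linarith
  have hTc : IsCompact T := by
    refine Metric.isCompact_of_isClosed_isBounded ?_ ?_
    · have hPP : IsCompact (P - P) := by
        rw [← Set.sub_image_prod]
        exact (hP.prod hP).image (by fun_prop)
      exact hPP.isClosed.preimage (by fun_prop : Continuous fun t : ℝ => t • w)
    · refine (Metric.isBounded_iff_subset_closedBall 0).2 ⟨D / ‖w‖, ?_⟩
      rintro t ⟨p, hp, q, hq, hpq⟩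
      have h1 := hD p hp q hq
      simp only at hpq
      rw [hpq, norm_smul] at h1
      rw [mem_closedBall_zero_iff, le_div_iff₀ hw0]
      exact h1
  obtain ⟨t, htT, htmax⟩ := hTc.exists_isGreatest ⟨_, hTne⟩
  have ht1 : η / ‖w‖ ≤ t := htmax hTne
  have ht0 : 0 < t := lt_of_lt_of_le (by positivity) ht1
  obtain ⟨p, hp, q, hq, hpq⟩ := htT
  simp only at hpq
  have hnorm : ‖p - q‖ = t * ‖w‖ := by rw [hpq, norm_smul, Real.norm_of_nonneg ht0.le]
  have hη' : η ≤ ‖p - q‖ := by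
    rw [hnorm]; rwa [div_le_iff₀ hw0] at ht1
  have hy : y = x + w := by simp [hw]
  have hwpq : w = t⁻¹ • (p - q) := by rw [hpq, smul_smul, inv_mul_cancel₀ ht0.ne', one_smul]
  refine ⟨(x - t⁻¹ • q, t⁻¹), by positivity, ?_, ?_, ?_, ?_, ?_⟩
  · exact mem_copySet.2 ⟨q, hq, by simp⟩
  · refine mem_copySet.2 ⟨p, hp, ?_⟩
    rw [hy, hwpq]; module
  · rintro c' hc' hlt ⟨h1, h2⟩
    obtain ⟨a, ha, hxa⟩ := mem_copySet.1 h1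
    obtain ⟨b, hb, hyb⟩ := mem_copySet.1 h2
    have : c'.2⁻¹ ∈ T := by
      refine ⟨b, hb, a, ha, ?_⟩
      simp only
      rw [hw, hyb, hxa, add_sub_add_left_eq_sub, ← smul_sub, smul_smul, inv_mul_cancel₀ hc'.ne', one_smul]
    have h3 := htmax this
    have h4 : t < c'.2⁻¹ := (lt_inv_comm₀ hc' ht0).1 hlt
    linarith
  · intro z hz
    obtain ⟨a, ha, rfl⟩ := mem_copySet.1 hz
    rw [Metric.mem_closedBall, dist_eq_norm]
    have : x - t⁻¹ • q + t⁻¹ • a - x = t⁻¹ • (a - q) := by rw [smul_sub]; abel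
    simp only
    rw [this, norm_smul, Real.norm_of_nonneg (by positivity)]
    have h1 : t⁻¹ ≤ ‖w‖ / η := by
      rw [inv_le_comm₀ ht0 (by positivity), inv_div]; exact ht1
    calc t⁻¹ * ‖a - q‖ ≤ (‖w‖ / η) * D := by
          gcongr
          exact hD a ha q hq
      _ = D / η * ‖w‖ := by ring
  · intro z hz
    refine mem_copySet.2 ⟨t • (z - x) + q, hδP p hp q hq hη' ?_, ?_⟩
    · rw [Metric.mem_ball, dist_eq_norm] at hz ⊢
      have : t • (z - x) + q - (1/2 : ℝ) • (p + q) = t • (z - (1/2 : ℝ) • (x + y)) := by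
        have hp' : p = q + t • w := by rw [← hpq]; abel
        rw [hp', hy]; module
      rw [this, norm_smul, Real.norm_of_nonneg ht0.le]
      calc t * ‖z - (1/2 : ℝ) • (x + y)‖ < t * (δ / D * ‖w‖) := by gcongr
        _ = δ * (‖p - q‖ / D) := by rw [hnorm]; ring
        _ ≤ δ * 1 := by
          gcongr
          rw [div_le_one hDpos]
          exact hD p hp q hq
        _ = δ := mul_one _
    · simp only [smul_add, smul_smul, inv_mul_cancel₀ ht0.ne', one_smul]
      abel

theorem cone_mem_interior {Q : Set E} (hQ : Convex ℝ Q) {x y z : E} {κ : ℝ}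
    (hx : x ∈ Q) (hball : Metric.ball ((1/2 : ℝ) • (x + y)) (κ * ‖y - x‖) ⊆ Q)
    (hxy : 0 < ‖y - x‖) (hz : 0 < ‖z - x‖) (hz2 : 2 * ‖z - x‖ ≤ ‖y - x‖)
    (hc : ‖‖y - x‖ • (z - x) - ‖z - x‖ • (y - x)‖ < 2 * κ * ‖y - x‖ * ‖z - x‖) :
    z ∈ interior Q := by
  set a := ‖y - x‖
  set b := ‖z - x‖
  have hg : x + (a / (2 * b)) • (z - x) ∈ interior Q := by
    refine interior_mono hball ?_
    rw [Metric.isOpen_ball.interior_eq, Metric.mem_ball, dist_eq_norm]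
    have : x + (a / (2 * b)) • (z - x) - (1/2 : ℝ) • (x + y)
        = (1 / (2 * b)) • (a • (z - x) - b • (y - x)) := by
      have h1 : (1 / (2 * b)) * b = 1 / 2 := by field_simp
      have h2 : (1 / (2 * b)) * a = a / (2 * b) := by field_simp
      rw [smul_sub (1 / (2 * b)), smul_smul, smul_smul, h1, h2]
      module
    rw [this, norm_smul, Real.norm_of_nonneg (by positivity)]
    calc 1 / (2 * b) * ‖a • (z - x) - b • (y - x)‖ < 1 / (2 * b) * (2 * κ * a * b) := by gcongr
      _ = κ * a := by field_simp
  have := hQ.add_smul_sub_mem_interior hx hg (t := 2 * b / a)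
    ⟨by positivity, by rw [div_le_one hxy]; exact hz2⟩
  convert this using 1
  rw [add_sub_cancel_left, smul_smul]
  have : 2 * b / a * (a / (2 * b)) = 1 := by field_simp
  rw [this, one_smul]; abel

/-- Baire category step. -/
theorem baire_step [CompleteSpace E] {R C : Set E} (hC : IsOpen C)
    (hgood : ∀ V : Set E, IsOpen V → (R ∩ V).Nonempty → ∃ a ∈ R ∩ V, ∃ b ∈ R ∩ V, b - a ∈ C)
    {V : Set E} (hV : IsOpen V) (hVR : (R ∩ V).Nonempty) :
    ∃ x ∈ V, ∀ δ > 0, ∃ x' ∈ R, ‖x' - x‖ < δ ∧ x' - x ∈ C := by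
  let F := closure R
  have hF : IsClosed F := isClosed_closure
  have : CompleteSpace F := hF.completeSpace_coe
  let G : ℕ → Set F := fun n => ⋃ x' ∈ R, {x : F | ‖x' - x‖ < 1 / ((n:ℝ) + 1) ∧ x' - (x:E) ∈ C}
  have hGo : ∀ n, IsOpen (G n) := by
    intro n
    refine isOpen_biUnion fun x' _ => ?_
    refine IsOpen.inter (isOpen_lt (f := fun x : F => ‖x' - (x:E)‖) (by fun_prop) continuous_const) ?_
    exact hC.preimage (by fun_prop : Continuous fun x : F => x' - (x : E))
  have hGd : ∀ n, Dense (G n) := by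
    intro n
    rw [dense_iff_inter_open]
    rintro _ ⟨W, hW, rfl⟩ ⟨⟨x, hx⟩, hxW⟩
    obtain ⟨z, hzW, hzR⟩ := mem_closure_iff.1 hx W hW hxW
    have hpos : (0:ℝ) < 1 / ((n:ℝ) + 1) := by positivity
    obtain ⟨a, ⟨haR, haW, haz⟩, b, ⟨hbR, hbW, hbz⟩, hab⟩ :=
      hgood (W ∩ Metric.ball z (1 / ((n:ℝ) + 1) / 2)) (hW.inter Metric.isOpen_ball)
        ⟨z, hzR, hzW, Metric.mem_ball_self (by positivity)⟩
    refine ⟨⟨a, subset_closure haR⟩, haW, ?_⟩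
    refine mem_biUnion hbR ⟨?_, hab⟩
    rw [← dist_eq_norm]
    have := dist_triangle_right b a z
    rw [Metric.mem_ball] at haz hbz
    simp only
    linarith
  have hd := dense_iInter_of_isOpen_nat hGo hGd
  obtain ⟨z, hzR, hzV⟩ := hVR
  obtain ⟨x, hxV, hxG⟩ := (dense_iff_inter_open.1 hd) _ (hV.preimage continuous_subtype_val)
    ⟨⟨z, subset_closure hzR⟩, hzV⟩
  refine ⟨x, hxV, fun δ hδ => ?_⟩
  obtain ⟨n, hn⟩ := exists_nat_one_div_lt hδ
  have := mem_iInter.1 hxG n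
  simp only [G, mem_iUnion] at this
  obtain ⟨x', hx', h1, h2⟩ := this
  exact ⟨x', hx', h1.trans hn, h2⟩

theorem good_cone {R : Set E} (hR : Preperfect R) {U : Set E} (hU : IsOpen U)
    (hUR : (R ∩ U).Nonempty) (s : Set E) (hs : s.Finite) (C : E → Set E)
    (hcov : ∀ w ≠ 0, ∃ u ∈ s, w ∈ C u) :
    ∃ u ∈ s, ∃ U₁ ⊆ U, IsOpen U₁ ∧ (R ∩ U₁).Nonempty ∧
      ∀ V ⊆ U₁, IsOpen V → (R ∩ V).Nonempty → ∃ a ∈ R ∩ V, ∃ b ∈ R ∩ V, b - a ∈ C u := by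
  by_contra! hcon
  have key : ∀ t : Set E, t.Finite → t ⊆ s → ∃ V ⊆ U, IsOpen V ∧ (R ∩ V).Nonempty ∧
      ∀ u ∈ t, ∀ a ∈ R ∩ V, ∀ b ∈ R ∩ V, b - a ∉ C u := by
    intro t ht
    induction t, ht using Set.Finite.induction_on with
    | empty => intro _; exact ⟨U, subset_rfl, hU, hUR, by simp⟩
    | @insert u t _ _ ih =>
      intro hts
      obtain ⟨V, hVU, hV, hVR, h⟩ := ih ((subset_insert _ _).trans hts)
      obtain ⟨W, hWV, hW, hWR, h'⟩ := hcon u (hts (mem_insert _ _)) V hVU hV hVR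
      refine ⟨W, hWV.trans hVU, hW, hWR, ?_⟩
      intro v hv a ha b hb
      rcases hv with rfl | hv
      · exact h' a ha b hb
      · exact h v hv a ⟨ha.1, hWV ha.2⟩ b ⟨hb.1, hWV hb.2⟩
  obtain ⟨V, -, hV, ⟨a, haR, haV⟩, h⟩ := key s hs subset_rfl
  obtain ⟨b, ⟨hbV, hbR⟩, hba⟩ := preperfect_iff_nhds.1 hR a haR V (hV.mem_nhds haV)
  obtain ⟨u, hu, hub⟩ := hcov (b - a) (sub_ne_zero.2 hba)
  exact h u hu a ⟨haR, haV⟩ b ⟨hbR, hbV⟩ hub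

theorem key_lemma [FiniteDimensional ℝ E] {P : Set E} (hP : IsCompact P)
    (hsc : StrictConvex ℝ P) (hnt : P.Nontrivial)
    {R : Set E} (hR : Preperfect R) {U : Set E} (hU : IsOpen U) (hUR : (R ∩ U).Nonempty) :
    ∃ c : E × ℝ, 0 < c.2 ∧ copySet P c ⊆ U ∧ ∀ c' : E × ℝ, 0 < c'.2 → c'.2 < c.2 →
      ∃ x ∈ R, x ∈ interior (copySet P c) \ copySet P c' := by
  have : ProperSpace E := FiniteDimensional.proper ℝ E
  have : CompleteSpace E := FiniteDimensional.complete ℝ E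
  obtain ⟨κ, hκ, K, hK, hgeo⟩ := geo_lemma hP hsc hnt
  obtain ⟨a₀, ha₀R, ha₀U⟩ := hUR
  obtain ⟨ε, hε, hεU⟩ := Metric.isOpen_iff.1 hU a₀ ha₀U
  set ε' := ε / (2 * (1 + 2 * K)) with hε'
  have hε'pos : 0 < ε' := by positivity
  obtain ⟨s, -, hsfin, hscov⟩ := finite_cover_balls_of_compact (isCompact_sphere (0:E) 1) hκ
  let C : E → Set E := fun u => {w | ‖w - ‖w‖ • u‖ < κ * ‖w‖}
  have hCo : ∀ u, IsOpen (C u) := fun u => isOpen_lt (by fun_prop) (by fun_prop)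
  have hC0 : ∀ u, ∀ w ∈ C u, 0 < ‖w‖ := by
    intro u w hw
    by_contra hcon
    have h0 : w = 0 := by
      rw [← norm_eq_zero]; exact le_antisymm (not_lt.1 hcon) (norm_nonneg _)
    subst h0
    simp [C] at hw
  have hcov : ∀ w ≠ 0, ∃ u ∈ s, w ∈ C u := by
    intro w hw
    have hw0 : 0 < ‖w‖ := norm_pos_iff.2 hw
    have h1 : ‖w‖⁻¹ • w ∈ Metric.sphere (0:E) 1 := by
      rw [mem_sphere_zero_iff_norm, norm_smul, norm_inv, norm_norm, inv_mul_cancel₀ hw0.ne']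
    obtain ⟨u, hu, hb⟩ := mem_iUnion₂.1 (hscov h1)
    refine ⟨u, hu, ?_⟩
    rw [Metric.mem_ball, dist_eq_norm] at hb
    have h2 : w - ‖w‖ • u = ‖w‖ • (‖w‖⁻¹ • w - u) := by
      rw [smul_sub, smul_smul, mul_inv_cancel₀ hw0.ne', one_smul]
    show ‖w - ‖w‖ • u‖ < κ * ‖w‖
    rw [h2, norm_smul, norm_norm, mul_comm]
    gcongr
  have hCC : ∀ u, ∀ w ∈ C u, ∀ w' ∈ C u, ‖‖w‖ • w' - ‖w'‖ • w‖ < 2 * κ * ‖w‖ * ‖w'‖ := by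
    intro u w hw w' hw'
    have h0 := hC0 u w hw
    have h0' := hC0 u w' hw'
    have h1 : ‖w‖ • w' - ‖w'‖ • w = ‖w‖ • (w' - ‖w'‖ • u) - ‖w'‖ • (w - ‖w‖ • u) := by module
    have hw1 : ‖w - ‖w‖ • u‖ < κ * ‖w‖ := hw
    have hw1' : ‖w' - ‖w'‖ • u‖ < κ * ‖w'‖ := hw'
    rw [h1]
    refine (norm_sub_le _ _).trans_lt ?_
    rw [norm_smul, norm_smul, norm_norm, norm_norm]
    nlinarith
  obtain ⟨u, hu, U₁, hU₁, hU₁o, hU₁R, hgood⟩ := good_cone hR (Metric.isOpen_ball (x := a₀) (ε := ε'))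
    ⟨a₀, ha₀R, Metric.mem_ball_self hε'pos⟩ s hsfin C hcov
  set R₁ := R ∩ U₁ with hR₁
  have hgood₁ : ∀ V : Set E, IsOpen V → (R₁ ∩ V).Nonempty →
      ∃ a ∈ R₁ ∩ V, ∃ b ∈ R₁ ∩ V, b - a ∈ C u := by
    rintro V hV ⟨z, ⟨hzR, hzU⟩, hzV⟩
    obtain ⟨a, ha, b, hb, hab⟩ := hgood (U₁ ∩ V) inter_subset_left (hU₁o.inter hV) ⟨z, hzR, hzU, hzV⟩
    exact ⟨a, ⟨⟨ha.1, ha.2.1⟩, ha.2.2⟩, b, ⟨⟨hb.1, hb.2.1⟩, hb.2.2⟩, hab⟩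
  have hgood₂ : ∀ V : Set E, IsOpen V → (R₁ ∩ V).Nonempty →
      ∃ a ∈ R₁ ∩ V, ∃ b ∈ R₁ ∩ V, b - a ∈ -C u := by
    intro V hV hne
    obtain ⟨a, ha, b, hb, hab⟩ := hgood₁ V hV hne
    exact ⟨b, hb, a, ha, by simpa using hab⟩
  obtain ⟨a, ⟨ha, -⟩, b, ⟨hb, -⟩, hab⟩ := hgood₁ univ isOpen_univ (by simpa using hU₁R)
  obtain ⟨x, ⟨hxU, hxb⟩, hx⟩ := baire_step (hCo u) hgood₁
    (V := U₁ ∩ {x | b - x ∈ C u})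
    (hU₁o.inter ((hCo u).preimage (by fun_prop : Continuous fun x : E => b - x)))
    ⟨a, ha, ha.2, hab⟩
  obtain ⟨y, ⟨hyU, hxy⟩, hy⟩ := baire_step (hCo u).neg hgood₂
    (V := U₁ ∩ {y | y - x ∈ C u})
    (hU₁o.inter ((hCo u).preimage (by fun_prop : Continuous fun y : E => y - x)))
    ⟨b, hb, hb.2, hxb⟩
  have hxy : y - x ∈ C u := hxy
  have hw0 : 0 < ‖y - x‖ := hC0 u _ hxy
  have hne : x ≠ y := by rintro rfl; simp at hw0
  obtain ⟨c, hc0, hxc, hyc, hmin, hcK, hcball⟩ := hgeo x y hne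
  have hx1 := hU₁ hxU
  have hy1 := hU₁ hyU
  rw [Metric.mem_ball] at hx1 hy1
  have hconv := copySet_convex hsc.convex c
  refine ⟨c, hc0, ?_, ?_⟩
  · refine hcK.trans (subset_trans ?_ hεU)
    intro z hz
    rw [Metric.mem_closedBall] at hz
    rw [Metric.mem_ball]
    have h1 : ‖y - x‖ ≤ 2 * ε' := by
      rw [← dist_eq_norm]
      linarith [dist_triangle_right y x a₀]
    have h2 : K * ‖y - x‖ ≤ K * (2 * ε') := by gcongr
    have h3 : ε' * (1 + 2 * K) = ε / 2 := by rw [hε']; field_simp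
    linarith [dist_triangle z x a₀]
  · intro c' hc' hlt
    have hcl : IsOpen (copySet P c')ᶜ := (copySet_compact hP c').isClosed.isOpen_compl
    have hor : x ∉ copySet P c' ∨ y ∉ copySet P c' := by
      by_contra! h
      exact hmin c' hc' hlt h
    rcases hor with h | h
    · obtain ⟨δ, hδ, hδs⟩ := Metric.isOpen_iff.1 hcl x h
      obtain ⟨z, hzR, hz1, hz2⟩ := hx (min δ (‖y - x‖ / 2)) (by positivity)
      refine ⟨z, hzR.1, ?_, hδs ?_⟩
      · refine cone_mem_interior hconv hxc hcball hw0 (hC0 u _ hz2) ?_ (hCC u _ hxy _ hz2)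
        linarith [min_le_right δ (‖y - x‖ / 2)]
      · rw [Metric.mem_ball, dist_eq_norm]
        exact hz1.trans_le (min_le_left _ _)
    · obtain ⟨δ, hδ, hδs⟩ := Metric.isOpen_iff.1 hcl y h
      obtain ⟨z, hzR, hz1, hz2⟩ := hy (min δ (‖y - x‖ / 2)) (by positivity)
      have hz2' : y - z ∈ C u := by simpa using hz2
      have hz0 := hC0 u _ hz2'
      refine ⟨z, hzR.1, ?_, hδs ?_⟩
      · refine cone_mem_interior (κ := κ) (y := x) hconv hyc ?_ ?_ ?_ ?_ ?_
        · rw [add_comm, norm_sub_rev]; exact hcball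
        · rwa [norm_sub_rev]
        · rwa [norm_sub_rev]
        · rw [norm_sub_rev x y]
          linarith [min_le_right δ (‖y - x‖ / 2)]
        · have := hCC u _ hxy _ hz2'
          rw [norm_sub_rev x y, norm_sub_rev z y, ← neg_sub y z, ← neg_sub y x, smul_neg, smul_neg,
            ← neg_sub', norm_neg]
          exact this
      · rw [Metric.mem_ball, dist_eq_norm]
        exact hz1.trans_le (min_le_left _ _)

theorem exists_preperfect [SecondCountableTopology E] {R : Set E} (hR : ¬ R.Countable) :
    ∃ R' ⊆ R, R'.Nonempty ∧ Preperfect R' := by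
  let R' : Set E := {x ∈ R | ∀ U ∈ 𝓝 x, ¬ (U ∩ R).Countable}
  have hc : (R \ R').Countable := by
    have h : ∀ x ∈ R \ R', ∃ U ∈ 𝓝 x, (U ∩ R).Countable := by
      rintro x ⟨hx, hx'⟩
      by_contra! h
      exact hx' ⟨hx, h⟩
    choose! f hf hfc using h
    obtain ⟨t, hts, htc, hcov⟩ := TopologicalSpace.countable_cover_nhdsWithin
      (f := f) (s := R \ R') (fun x hx => mem_nhdsWithin_of_mem_nhds (hf x hx))
    refine (htc.biUnion (t := fun x _ => f x ∩ R) fun x hx => hfc x (hts hx)).mono ?_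
    intro z hz
    obtain ⟨x, hx, hzx⟩ := mem_iUnion₂.1 (hcov hz)
    exact mem_iUnion₂.2 ⟨x, hx, hzx, hz.1⟩
  refine ⟨R', sep_subset _ _, ?_, ?_⟩
  · by_contra hne
    rw [not_nonempty_iff_eq_empty] at hne
    rw [hne, sdiff_empty] at hc
    exact hR hc
  · rw [preperfect_iff_nhds]
    intro x hx U hU
    by_contra! hcon
    refine hx.2 U hU ((hc.union (countable_singleton x)).mono ?_)
    rintro z ⟨hzU, hzR⟩
    by_cases hz : z ∈ R'
    · exact Or.inr (hcon z ⟨hzU, hz⟩)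
    · exact Or.inl ⟨hzR, hz⟩

theorem shrink_lemma {P : Set E} (hP : IsCompact P) (hint : (interior P).Nonempty) :
    ∃ s : E × ℝ → E × ℝ, ∀ c, 0 < c.2 → 0 < (s c).2 ∧ (s c).2 < c.2 ∧
      ∀ c', 0 < c'.2 → copySet P c' ⊆ copySet P c \ copySet P (s c) → c'.2 ≤ c.2 / 2 := by
  obtain ⟨o, ho⟩ := hint
  obtain ⟨r, hr, hrP⟩ := Metric.isOpen_iff.1 isOpen_interior o ho
  have hrP' : Metric.ball o r ⊆ P := hrP.trans interior_subset
  have hoP : o ∈ P := interior_subset ho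
  set D := Metric.diam P with hD
  have hD0 : 0 ≤ D := Metric.diam_nonneg
  set ε := r / (4 * (D + 1)) with hε
  have hεpos : 0 < ε := by positivity
  set t := 1 / (1 + ε) with ht
  have ht0 : 0 < t := by positivity
  have ht1 : t < 1 := by rw [ht, div_lt_one (by positivity)]; linarith
  refine ⟨fun c => (c.1 + (c.2 * (1 - t)) • o, c.2 * t), fun c hc => ⟨by positivity, ?_, ?_⟩⟩
  · simp only; nlinarith
  intro c' hc' hsub
  by_contra! hlt
  have hz : c'.1 + c'.2 • o ∈ copySet P c' := mem_copySet.2 ⟨o, hoP, rfl⟩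
  obtain ⟨hz1, hz2⟩ := hsub hz
  obtain ⟨w, hw, hzw⟩ := mem_copySet.1 hz1
  apply hz2
  refine mem_copySet.2 ⟨w + ε • (w - o), ?_, ?_⟩
  · -- the point of `copySet P c'` displaced
    have hq : c'.1 + c'.2 • (o + (c.2 / c'.2 * ε) • (w - o)) ∈ copySet P c' := by
      refine mem_copySet.2 ⟨_, hrP' ?_, rfl⟩
      rw [Metric.mem_ball, dist_eq_norm, add_sub_cancel_left, norm_smul,
        Real.norm_of_nonneg (by positivity)]
      have h1 : ‖w - o‖ ≤ D := by
        rw [← dist_eq_norm]; exact Metric.dist_le_diam_of_mem hP.isBounded hw hoP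
      have h2 : c.2 / c'.2 ≤ 2 := by rw [div_le_iff₀ hc']; linarith
      have h3 : ε * (D + 1) = r / 4 := by rw [hε]; field_simp
      calc c.2 / c'.2 * ε * ‖w - o‖ ≤ 2 * ε * D := by gcongr
        _ < r := by nlinarith
    obtain ⟨v, hv, hvq⟩ := mem_copySet.1 (hsub hq).1
    have h4 : c.2 • v = c.2 • (w + ε • (w - o)) := by
      have h5 : c'.2 * (c.2 / c'.2 * ε) = c.2 * ε := by field_simp
      rw [smul_add, smul_smul, h5, ← add_assoc, hzw, add_assoc] at hvq
      rw [← add_left_cancel hvq, smul_add, smul_smul]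
    have := smul_right_injective E hc.ne' h4
    rwa [← this]
  · rw [hzw]
    have h5 : t * (1 + ε) = 1 := by rw [ht]; field_simp
    have h6 : c.2 * t * ε = c.2 * (1 - t) := by linear_combination c.2 * h5
    simp only
    have h7 : (c.2 * t) • (w + ε • (w - o)) = (c.2 * t * (1 + ε)) • w - (c.2 * t * ε) • o := by
      module
    rw [h7, h6, mul_assoc, h5]
    module

end Geo

section Runs

variable {M : Type*}

def runOf (a b : ℕ → M) : ℕ → M := fun n => if n % 2 = 0 then a (n / 2) else b (n / 2)

theorem runOf_even (a b : ℕ → M) (n : ℕ) : runOf a b (2 * n) = a n := by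
  unfold runOf
  rw [if_pos (by omega)]
  congr 1; omega

theorem runOf_odd (a b : ℕ → M) (n : ℕ) : runOf a b (2 * n + 1) = b n := by
  unfold runOf
  rw [if_neg (by omega)]
  congr 1; omega

theorem ofFn_step1 (m : ℕ → M) (n : ℕ) :
    (List.ofFn fun i : Fin (n + 1) => m i) = (List.ofFn fun i : Fin n => m i) ++ [m n] := by
  rw [List.ofFn_succ_last]; simp

theorem ofFn_step2 (m : ℕ → M) (n : ℕ) :
    (List.ofFn fun i : Fin (2 * (n + 1)) => m i)
      = (List.ofFn fun i : Fin (2 * n) => m i) ++ [m (2 * n), m (2 * n + 1)] := by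
  have h1 := ofFn_step1 m (2 * n + 1)
  have h2 := ofFn_step1 m (2 * n)
  rw [h2, List.append_assoc] at h1
  exact h1

theorem ofFn_runOf (a b : ℕ → M) (pos : ℕ → List M) (h0 : pos 0 = [])
    (hs : ∀ n, pos (n + 1) = pos n ++ [a n, b n]) (n : ℕ) :
    (List.ofFn fun i : Fin (2 * n) => runOf a b i) = pos n := by
  induction n with
  | zero => simp [h0]
  | succ n ih => rw [ofFn_step2, ih, hs, runOf_even, runOf_odd]

end Runs

section Game

variable {E : Type*} [NormedAddCommGroup E] [NormedSpace ℝ E]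

theorem rule_zero {P : Set E} {m : ℕ → E × ℝ} : Rule P m (2 * 0) ↔ 0 < (m 0).2 := by
  simp [Rule]

theorem rule_odd {P : Set E} {m : ℕ → E × ℝ} (n : ℕ) :
    Rule P m (2 * n + 1) ↔ 0 < (m (2 * n + 1)).2 ∧ (m (2 * n + 1)).2 < (m (2 * n)).2 := by
  unfold Rule
  rw [if_pos (by omega), Nat.add_sub_cancel]

theorem rule_even {P : Set E} {m : ℕ → E × ℝ} (n : ℕ) :
    Rule P m (2 * (n + 1)) ↔ 0 < (m (2 * (n + 1))).2 ∧
      copySet P (m (2 * (n + 1))) ⊆ copySet P (m (2 * n)) \ copySet P (m (2 * n + 1)) := by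
  unfold Rule
  rw [if_neg (by omega), show 2 * (n + 1) - 2 = 2 * n by omega,
    show 2 * (n + 1) - 1 = 2 * n + 1 by omega]
  simp

def region (P : Set E) (l : List (E × ℝ)) : Set E :=
  match l.reverse with
  | b :: a :: _ => interior (copySet P a) \ copySet P b
  | _ => univ

theorem region_nil (P : Set E) : region P [] = univ := rfl

theorem region_append (P : Set E) (l : List (E × ℝ)) (a b : E × ℝ) :
    region P (l ++ [a, b]) = interior (copySet P a) \ copySet P b := by
  simp [region]

theorem region_open {P : Set E} (hP : IsCompact P) (l : List (E × ℝ)) : IsOpen (region P l) := by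
  unfold region
  split
  · exact isOpen_interior.sdiff (copySet_compact hP _).isClosed
  · exact isOpen_univ

/-- countable target: II wins -/
theorem winII_of_countable {P A : Set E} (hne : P.Nonempty) (hA : A.Countable) :
    ∃ σ, WinningII P A σ := by
  obtain ⟨f, hf⟩ := Set.countable_iff_exists_subset_range.1 hA
  obtain ⟨q, hq⟩ := hne
  refine ⟨fun l => (f (l.length / 2) - (((l.getLast?).getD (0, 1)).2 / 2) • q,
    ((l.getLast?).getD (0, 1)).2 / 2), ?_⟩
  intro m hm
  have hm' : ∀ n, m (2 * n + 1) = (f n - ((m (2 * n)).2 / 2) • q, (m (2 * n)).2 / 2) := by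
    intro n
    have h := hm n
    rw [ofFn_step1] at h
    simpa [show (2 * n + 1) / 2 = n by omega] using h
  constructor
  · intro n hn
    have hpos := (hn (2 * n) (by omega)).1
    rw [rule_odd, hm']
    simp only
    constructor <;> linarith
  · intro hr
    rw [eq_empty_iff_forall_notMem]
    rintro x ⟨hx, hxA⟩
    obtain ⟨n, rfl⟩ := hf hxA
    have h1 := mem_iInter.1 hx (n + 1)
    have h2 := (((rule_even n).1 (hr (2 * (n + 1)))).2 h1).2
    apply h2
    rw [hm']
    exact mem_copySet.2 ⟨q, hq, by simp⟩

theorem winI_of_perfect [FiniteDimensional ℝ E] {P A : Set E} (hP : IsCompact P)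
    (hsc : StrictConvex ℝ P) (hnt : P.Nontrivial) (hA : ContainsPerfectSet A) :
    ∃ σ, WinningI P A σ := by
  classical
  obtain ⟨F, hFA, hF, hFne⟩ := hA
  have hkey : ∀ l : List (E × ℝ), (F ∩ region P l).Nonempty → ∃ c : E × ℝ, 0 < c.2 ∧
      copySet P c ⊆ region P l ∧ ∀ c' : E × ℝ, 0 < c'.2 → c'.2 < c.2 →
      ∃ x ∈ F, x ∈ interior (copySet P c) \ copySet P c' := fun l hl =>
    key_lemma hP hsc hnt hF.acc (region_open hP l) hl
  choose! σ hσ1 hσ2 hσ3 using hkey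
  refine ⟨σ, fun m hm => ?_⟩
  have claim : ∀ n, (∀ k < 2 * n, Rule P m k) →
      (F ∩ region P (List.ofFn fun i : Fin (2 * n) => m i)).Nonempty := by
    intro n
    induction n with
    | zero => intro _; simpa [region_nil] using hFne
    | succ n ih =>
      intro hr
      have hne := ih fun k hk => hr k (by omega)
      have h1 := (rule_odd n).1 (hr (2 * n + 1) (by omega))
      have h3 := hσ3 _ hne (m (2 * n + 1)) h1.1
      rw [← hm n] at h3
      obtain ⟨x, hxF, hx⟩ := h3 h1.2
      refine ⟨x, hxF, ?_⟩
      rw [ofFn_step2, region_append]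
      exact hx
  constructor
  · intro n hn
    have hne := claim n hn
    have h1 := hσ1 _ hne
    have h2 := hσ2 _ hne
    rw [← hm n] at h1 h2
    cases n with
    | zero => exact rule_zero.2 h1
    | succ n =>
      rw [ofFn_step2, region_append] at h2
      exact (rule_even n).2 ⟨h1, h2.trans (sdiff_subset_sdiff_left interior_subset)⟩
  · intro hr
    have hcl : ∀ n, IsClosed (F ∩ copySet P (m (2 * n))) := fun n =>
      hF.closed.inter (copySet_compact hP _).isClosed
    have := IsCompact.nonempty_iInter_of_sequence_nonempty_isCompact_isClosed
      (fun n => F ∩ copySet P (m (2 * n))) ?_ ?_ ?_ hcl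
    · obtain ⟨x, hx⟩ := this
      rw [mem_iInter] at hx
      exact ⟨x, mem_iInter.2 fun n => (hx n).2, hFA (hx 0).1⟩
    · intro n
      exact inter_subset_inter_right _
        (((rule_even n).1 (hr (2 * (n + 1)))).2.trans sdiff_subset)
    · intro n
      obtain ⟨x, hxF, hx⟩ := claim (n + 1) fun k _ => hr k
      rw [ofFn_step2, region_append] at hx
      exact ⟨x, hxF, interior_subset hx.1⟩
    · exact (copySet_compact hP _).inter_left hF.closed

def posII (σ : Strategy E) (a : ℕ → E × ℝ) : ℕ → List (E × ℝ)
  | 0 => []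
  | n + 1 => posII σ a n ++ [a n, σ (posII σ a n ++ [a n])]

theorem posII_congr (σ : Strategy E) {a a' : ℕ → E × ℝ} {n : ℕ} (h : ∀ i < n, a i = a' i) :
    posII σ a n = posII σ a' n := by
  induction n with
  | zero => rfl
  | succ n ih =>
    simp only [posII]
    rw [ih fun i hi => h i (by omega), h n (by omega)]

theorem rules_posII {P A : Set E} {σ : Strategy E} (hσ : WinningII P A σ) (a : ℕ → E × ℝ) :
    FollowsII σ (runOf a fun n => σ (posII σ a n ++ [a n])) ∧
    ∀ n, (∀ k < n, 0 < (a k).2 ∧ copySet P (a k) ⊆ region P (posII σ a k)) →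
      ∀ k < 2 * n, Rule P (runOf a fun n => σ (posII σ a n ++ [a n])) k := by
  set b := fun n => σ (posII σ a n ++ [a n]) with hb
  have hfol : FollowsII σ (runOf a b) := by
    intro n
    rw [ofFn_step1, ofFn_runOf a b (posII σ a) rfl (fun n => rfl), runOf_odd, runOf_even]
  refine ⟨hfol, fun n => ?_⟩
  induction n with
  | zero => intro _ k hk; omega
  | succ n ih =>
    intro h
    have ih' := ih fun k hk => h k (by omega)
    obtain ⟨h1, h2⟩ := h n (by omega)
    have heven : Rule P (runOf a b) (2 * n) := by
      cases n with
      | zero => rw [rule_zero]; exact h1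
      | succ n =>
        rw [rule_even, runOf_even, runOf_even, runOf_odd]
        simp only [posII, region_append] at h2
        exact ⟨h1, h2.trans (sdiff_subset_sdiff_left interior_subset)⟩
    have hlt : ∀ k < 2 * n + 1, Rule P (runOf a b) k := by
      intro k hk
      rcases Nat.lt_succ_iff_lt_or_eq.1 hk with hk | rfl
      · exact ih' k hk
      · exact heven
    intro k hk
    rcases Nat.lt_succ_iff_lt_or_eq.1 (show k < (2 * n + 1) + 1 by omega) with hk | rfl
    · exact hlt k hk
    · exact (hσ _ hfol).1 n hlt

theorem countable_of_winII [FiniteDimensional ℝ E] {P A : Set E} (hP : IsCompact P)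
    (hsc : StrictConvex ℝ P) (hnt : P.Nontrivial) {σ : Strategy E} (hσ : WinningII P A σ) :
    A.Countable := by
  classical
  have : ProperSpace E := FiniteDimensional.proper ℝ E
  let I : List (E × ℝ) → Set (E × ℝ) := fun p => {c | 0 < c.2 ∧ copySet P c ⊆ region P p}
  let O : List (E × ℝ) → E × ℝ → Set E := fun p c =>
    interior (copySet P c) \ copySet P (σ (p ++ [c]))
  have hOo : ∀ p c, IsOpen (O p c) := fun p c =>
    isOpen_interior.sdiff (copySet_compact hP _).isClosed
  have hM := fun p => TopologicalSpace.isOpen_biUnion_countable (I p) (O p) fun c _ => hOo p c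
  choose M hMI hMc hMU using hM
  let S : ℕ → Set (List (E × ℝ)) := fun n =>
    {p | ∃ a : ℕ → E × ℝ, (∀ k < n, a k ∈ M (posII σ a k)) ∧ p = posII σ a n}
  have hSc : ∀ n, (S n).Countable := by
    intro n
    induction n with
    | zero =>
      refine (countable_singleton ([] : List (E × ℝ))).mono ?_
      rintro p ⟨a, -, rfl⟩
      rfl
    | succ n ih =>
      refine (ih.biUnion (t := fun p _ => (fun c => p ++ [c, σ (p ++ [c])]) '' M p)
        fun p _ => (hMc p).image _).mono ?_
      rintro p ⟨a, ha, rfl⟩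
      refine mem_iUnion₂.2 ⟨posII σ a n, ⟨a, fun k hk => ha k (by omega), rfl⟩, a n, ha n (by omega), rfl⟩
  let N : List (E × ℝ) → Set E := fun p => (A ∩ region P p) \ ⋃ c ∈ M p, O p c
  have hN : ∀ n, ∀ p ∈ S n, (N p).Countable := by
    rintro n _ ⟨a, ha, rfl⟩
    set p := posII σ a n with hp
    by_contra hunc
    obtain ⟨R, hRN, ⟨z, hz⟩, hRp⟩ := exists_preperfect hunc
    obtain ⟨c, hc0, hcp, hc⟩ := key_lemma hP hsc hnt hRp (region_open hP p) ⟨z, hz, (hRN hz).1.2⟩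
    let a' := Function.update a n c
    have ha' : ∀ k < n, a' k = a k := fun k hk => Function.update_of_ne (by omega) _ _
    have han : a' n = c := Function.update_self _ _ _
    have hpos : ∀ k ≤ n, posII σ a' k = posII σ a k := fun k hk =>
      posII_congr σ fun i hi => ha' i (by omega)
    have hr := (rules_posII hσ a').2 (n + 1) (by
      intro k hk
      rw [hpos k (by omega)]
      rcases Nat.lt_succ_iff_lt_or_eq.1 hk with hk | rfl
      · rw [ha' k hk]
        exact hMI _ (ha k hk)
      · rw [han]; exact ⟨hc0, hcp⟩) (2 * n + 1) (by omega)
    rw [rule_odd, runOf_even, runOf_odd, hpos n le_rfl, han] at hr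
    obtain ⟨x, hxR, hx⟩ := hc _ hr.1 hr.2
    have h1 : x ∈ ⋃ c ∈ I p, O p c := mem_iUnion₂.2 ⟨c, ⟨hc0, hcp⟩, hx⟩
    rw [← hMU] at h1
    exact (hRN hxR).2 h1
  refine (countable_iUnion fun n => (hSc n).biUnion (t := fun p _ => N p) (hN n)).mono ?_
  intro x hxA
  by_contra hx
  simp only [mem_iUnion, not_exists] at hx
  let g : List (E × ℝ) → E × ℝ := fun p =>
    if h : ∃ c ∈ M p, x ∈ O p c then h.choose else 0
  let q : ℕ → List (E × ℝ) := fun n =>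
    Nat.rec [] (fun _ p => p ++ [g p, σ (p ++ [g p])]) n
  let a : ℕ → E × ℝ := fun n => g (q n)
  have hqa : ∀ n, posII σ a n = q n := by
    intro n
    induction n with
    | zero => rfl
    | succ n ih => simp only [posII]; rw [ih]
  have step : ∀ n, (∀ k < n, a k ∈ M (posII σ a k)) → x ∈ region P (posII σ a n) →
      a n ∈ M (posII σ a n) ∧ x ∈ O (posII σ a n) (a n) := by
    intro n h1 h2
    have h3 := hx n _ ⟨a, h1, rfl⟩
    have h4 : ∃ c ∈ M (posII σ a n), x ∈ O (posII σ a n) c := by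
      by_contra! h
      refine h3 ⟨⟨hxA, h2⟩, ?_⟩
      simpa using h
    have h5 : a n = h4.choose := by
      have h6 : a n = g (posII σ a n) := by rw [hqa]
      exact h6.trans (dif_pos h4)
    rw [h5]
    exact h4.choose_spec
  have claim : ∀ n, (∀ k < n, a k ∈ M (posII σ a k)) ∧ x ∈ region P (posII σ a n) := by
    intro n
    induction n with
    | zero => exact ⟨fun k hk => by omega, mem_univ _⟩
    | succ n ih =>
      have h := step n ih.1 ih.2
      constructor
      · intro k hk
        rcases Nat.lt_succ_iff_lt_or_eq.1 hk with hk | rfl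
        · exact ih.1 k hk
        · exact h.1
      · simp only [posII, region_append]
        exact h.2
  obtain ⟨hfol, hr⟩ := rules_posII hσ a
  have hrules : ∀ n, Rule P (runOf a fun n => σ (posII σ a n ++ [a n])) n := fun n =>
    hr (n + 1) (fun k hk => hMI _ ((claim (k + 1)).1 k (by omega))) n (by omega)
  have hemp := (hσ _ hfol).2 hrules
  have : x ∈ (∅ : Set E) := by
    rw [← hemp]
    refine ⟨mem_iInter.2 fun n => ?_, hxA⟩
    rw [runOf_even]
    exact interior_subset (step n (claim n).1 (claim n).2).2.1
  exact this

def replyI (σ : Strategy E) (s : E × ℝ → E × ℝ) (p : List (E × ℝ)) : Bool → E × ℝ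
  | false => s (σ p)
  | true => σ (p ++ [σ p, s (σ p)])

def posI (σ : Strategy E) (s : E × ℝ → E × ℝ) (c : ℕ → Bool) : ℕ → List (E × ℝ)
  | 0 => []
  | n + 1 => posI σ s c n ++ [σ (posI σ s c n), replyI σ s (posI σ s c n) (c n)]

theorem posI_congr (σ : Strategy E) (s : E × ℝ → E × ℝ) {c c' : ℕ → Bool} {n : ℕ}
    (h : ∀ i < n, c i = c' i) : posI σ s c n = posI σ s c' n := by
  induction n with
  | zero => rfl
  | succ n ih =>
    simp only [posI]
    rw [ih fun i hi => h i (by omega), h n (by omega)]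

theorem perfect_of_winI [FiniteDimensional ℝ E] {P A : Set E} (hP : IsCompact P)
    (hint : (interior P).Nonempty) {σ : Strategy E} (hσ : WinningI P A σ) :
    ContainsPerfectSet A := by
  have : ProperSpace E := FiniteDimensional.proper ℝ E
  obtain ⟨s, hs⟩ := shrink_lemma hP hint
  let run : (ℕ → Bool) → ℕ → E × ℝ := fun c =>
    runOf (fun n => σ (posI σ s c n)) (fun n => replyI σ s (posI σ s c n) (c n))
  have hev : ∀ c n, run c (2 * n) = σ (posI σ s c n) := fun c n => runOf_even _ _ _
  have hod : ∀ c n, run c (2 * n + 1) = replyI σ s (posI σ s c n) (c n) := fun c n =>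
    runOf_odd _ _ _
  have hfol : ∀ c, FollowsI σ (run c) := by
    intro c n
    rw [hev, ofFn_runOf _ _ (posI σ s c) rfl (fun n => rfl)]
  have hrule : ∀ n c, ∀ k < 2 * n, Rule P (run c) k := by
    intro n
    induction n with
    | zero => intro c k hk; omega
    | succ n ih =>
      have h0 : ∀ c, Rule P (run c) (2 * n) := fun c => (hσ _ (hfol c)).1 n (ih c)
      have hf : ∀ c, c n = false → Rule P (run c) (2 * n + 1) := by
        intro c hc
        have h1 := (h0 c).1
        rw [hev] at h1
        rw [rule_odd, hev, hod, hc]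
        exact ⟨(hs _ h1).1, (hs _ h1).2.1⟩
      have comb : ∀ c, Rule P (run c) (2 * n + 1) → ∀ k < 2 * (n + 1), Rule P (run c) k := by
        intro c hc k hk
        rcases Nat.lt_succ_iff_lt_or_eq.1 (show k < (2 * n + 1) + 1 by omega) with hk | rfl
        · rcases Nat.lt_succ_iff_lt_or_eq.1 hk with hk | rfl
          · exact ih c k hk
          · exact h0 c
        · exact hc
      intro c
      apply comb
      cases hc : c n with
      | false => exact hf c hc
      | true =>
        let c' := Function.update c n false
        have hc'n : c' n = false := Function.update_self _ _ _
        have hpos : posI σ s c' n = posI σ s c n := posI_congr σ s fun i hi =>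
          Function.update_of_ne (by omega) _ _
        have h1 := (hσ _ (hfol c')).1 (n + 1) (comb c' (hf c' hc'n))
        rw [rule_even, hev, hev, hod, hc'n] at h1
        simp only [posI] at h1
        rw [hc'n, hpos] at h1
        have h2 := (h0 c).1
        rw [hev] at h2
        rw [rule_odd, hev, hod, hc]
        have h3 := (hs _ h2).2.2 _ h1.1 h1.2
        refine ⟨h1.1, lt_of_le_of_lt h3 (by linarith)⟩
  have hrule' : ∀ c n, Rule P (run c) n := fun c n => hrule (n + 1) c n (by omega)
  let Q : (ℕ → Bool) → ℕ → Set E := fun c n => copySet P (σ (posI σ s c n))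
  have hpos : ∀ c n, 0 < (σ (posI σ s c n)).2 := by
    intro c n
    have := (hrule' c (2 * n)).1
    rwa [hev] at this
  have hQ : ∀ c n, Q c (n + 1) ⊆ Q c n \ copySet P (replyI σ s (posI σ s c n) (c n)) := by
    intro c n
    have := ((rule_even n).1 (hrule' c (2 * (n + 1)))).2
    rwa [hev, hev, hod] at this
  have hQb : ∀ c n, Bornology.IsBounded (Q c n) := fun c n => (copySet_compact hP _).isBounded
  have hdiam1 : ∀ c n, Metric.diam (Q c (n + 1)) ≤ Metric.diam (Q c n) := fun c n =>
    Metric.diam_mono ((hQ c n).trans sdiff_subset) (hQb c n)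
  have hdiam2 : ∀ c n, c n = false → Metric.diam (Q c (n + 1)) ≤ Metric.diam (Q c n) / 2 := by
    intro c n hc
    have h1 := hQ c n
    rw [hc] at h1
    have h2 := (hs _ (hpos c n)).2.2 _ (hpos c (n + 1)) h1
    simp only [Q]
    rw [copySet_diam _ (hpos _ _), copySet_diam _ (hpos _ _)]
    nlinarith [Metric.diam_nonneg (s := P)]
  let Γ : (ℕ → Bool) → ℕ → Bool := fun b n => if n % 2 = 1 then b (n / 2) else false
  have hΓe : ∀ b n, Γ b (2 * n) = false := by
    intro b n
    simp only [Γ]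
    rw [if_neg (by omega)]
  have hΓo : ∀ b n, Γ b (2 * n + 1) = b n := by
    intro b n
    simp only [Γ]
    rw [if_pos (by omega), show (2 * n + 1) / 2 = n by omega]
  set D := Metric.diam (copySet P (σ [])) with hD
  have hdiam : ∀ b n, Metric.diam (Q (Γ b) (2 * n)) ≤ (1 / 2) ^ n * D := by
    intro b n
    induction n with
    | zero => simp [Q, posI, hD]
    | succ n ih =>
      have h1 := hdiam2 (Γ b) (2 * n) (hΓe b n)
      have h2 := hdiam1 (Γ b) (2 * n + 1)
      rw [show 2 * (n + 1) = 2 * n + 1 + 1 by ring, pow_succ]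
      linarith
  have hex : ∀ b, ∃ x ∈ A, ∀ n, x ∈ Q (Γ b) n := by
    intro b
    obtain ⟨x, hx, hxA⟩ := (hσ _ (hfol (Γ b))).2 (hrule' (Γ b))
    refine ⟨x, hxA, fun n => ?_⟩
    have := mem_iInter.1 hx n
    rwa [hev] at this
  choose f hfA hfQ using hex
  have hcont : Continuous f := by
    rw [continuous_iff_continuousAt]
    intro b
    rw [ContinuousAt, Metric.tendsto_nhds]
    intro ε hε
    have hlim : Tendsto (fun n : ℕ => (1 / 2 : ℝ) ^ n * D) atTop (𝓝 0) := by
      have := (tendsto_pow_atTop_nhds_zero_of_lt_one (r := (1/2 : ℝ)) (by norm_num)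
        (by norm_num)).mul_const D
      simpa using this
    obtain ⟨n, hn⟩ := (hlim.eventually (gt_mem_nhds hε)).exists
    have hev' : ∀ᶠ b' in 𝓝 b, ∀ i ∈ Finset.range n, b' i = b i := by
      rw [Filter.eventually_all_finset]
      intro i _
      have h1 : Tendsto (fun b' : ℕ → Bool => b' i) (𝓝 b) (𝓝 (b i)) := (continuous_apply i).tendsto b
      rw [nhds_discrete Bool, tendsto_pure] at h1
      exact h1
    filter_upwards [hev'] with b' hb'
    have hp : posI σ s (Γ b') (2 * n) = posI σ s (Γ b) (2 * n) := by
      refine posI_congr σ s fun i hi => ?_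
      simp only [Γ]
      split_ifs
      · exact hb' _ (Finset.mem_range.2 (by omega))
      · rfl
    have h1 := hfQ b' (2 * n)
    simp only [Q] at h1
    rw [hp] at h1
    exact (Metric.dist_le_diam_of_mem (hQb (Γ b) (2 * n)) h1 (hfQ b (2 * n))).trans_lt
      ((hdiam b n).trans_lt hn)
  have hdisj : ∀ b b' : ℕ → Bool, ∀ k, (∀ i < k, b i = b' i) → b k = false → b' k = true →
      f b ≠ f b' := by
    intro b b' k hlt hb hb' heq
    have hp : posI σ s (Γ b) (2 * k + 1) = posI σ s (Γ b') (2 * k + 1) := by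
      refine posI_congr σ s fun i hi => ?_
      simp only [Γ]
      split_ifs
      · exact hlt _ (by omega)
      · rfl
    have h1 := (hQ (Γ b') (2 * k + 1) (hfQ b' _)).2
    have h2 := hfQ b (2 * k + 1 + 1)
    apply h1
    rw [← heq, hΓo, hb', ← hp]
    simp only [Q, posI] at h2
    rw [hΓo, hb] at h2
    exact h2
  have hinj : Function.Injective f := by
    intro b b' heq
    by_contra hne
    have hex : ∃ k, b k ≠ b' k := Function.ne_iff.1 hne
    classical
    have h1 := Nat.find_spec hex
    have h2 : ∀ i < Nat.find hex, b i = b' i := fun i hi => by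
      have := Nat.find_min hex hi
      push Not at this
      exact this
    generalize Nat.find hex = k at h1 h2
    cases hb : b k with
    | false =>
      cases hb' : b' k with
      | false => exact h1 (hb.trans hb'.symm)
      | true => exact hdisj b b' k h2 hb hb' heq
    | true =>
      cases hb' : b' k with
      | false => exact hdisj b' b k (fun i hi => (h2 i hi).symm) hb' hb heq.symm
      | true => exact h1 (hb.trans hb'.symm)
  have hclosed : IsClosed (range f) := (isCompact_range hcont).isClosed
  have hunc : ¬ (range f).Countable := by
    intro hc
    have h1 := hc.to_subtype
    have h2 : Countable (ℕ → Bool) := (Equiv.ofInjective f hinj).countable_iff.2 h1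
    obtain ⟨g, hg⟩ := exists_surjective_nat (ℕ → Bool)
    obtain ⟨n, hn⟩ := hg fun n => !(g n n)
    have h3 := congrFun hn n
    simp at h3
  obtain ⟨F, hF, hFne, hFs⟩ := exists_perfect_nonempty_of_isClosed_of_not_countable hclosed hunc
  refine ⟨F, hFs.trans ?_, hF, hFne⟩
  rintro _ ⟨b, rfl⟩
  exact hfA b

end Game

/-- **Theorem (strictly convex case).** Let `d ≥ 1` and let `P ⊆ ℝ^d` be a nondegenerate
compact strictly convex set.  Then for every target set `A ⊆ ℝ^d` the no-β McMullen game
`G_P(A)` is equivalent to the perfect set game: player I has a winning strategy iff `A`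
contains a perfect set, and player II has a winning strategy iff `A` is countable. -/
theorem noBeta_mcMullen_strictlyConvex (d : ℕ) (hd : 1 ≤ d)
    (P : Set (EuclideanSpace ℝ (Fin d))) (hPcomp : IsCompact P)
    (hPsc : StrictConvex ℝ P) (hPnd : P.Nontrivial)
    (A : Set (EuclideanSpace ℝ (Fin d))) :
    ((∃ σ, WinningI P A σ) ↔ ContainsPerfectSet A) ∧
    ((∃ σ, WinningII P A σ) ↔ A.Countable) := by
  have hint : (interior P).Nonempty := by
    obtain ⟨p, hp, q, hq, hpq⟩ := hPnd
    exact ⟨_, hPsc hp hq hpq (by norm_num : (0:ℝ) < 1/2) (by norm_num : (0:ℝ) < 1/2) (by norm_num)⟩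
  refine ⟨⟨?_, winI_of_perfect hPcomp hPsc hPnd⟩, ⟨?_, winII_of_countable hPnd.nonempty⟩⟩
  · rintro ⟨σ, hσ⟩
    exact perfect_of_winI hPcomp hint hσ
  · rintro ⟨σ, hσ⟩
    exact countable_of_winII hPcomp hPsc hPnd hσ
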